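/- Let 𝖯 be a Γ-Whitehead partition based at a vertex m. If 𝖯 splits a vertex v, then lk(v) ⊆ lk(m) (i.e. v ≤_f m). -/

import Mathlib

variable {V : Type*}

/-- The star of a vertex: the vertex together with its neighbors. -/
def gstar (Γ : SimpleGraph V) (v : V) : Set V :=
  insert v (Γ.neighborSet v)

/-- A Γ-Whitehead partition based at the vertex `m`: a partition of
`V± = V × Bool` (where `(v, true)` is `v⁺` and `(v, false)` is `v⁻`) into the
two sides `plus`, `minus` and the part `lk(m)± = {x | x.1 ∈ lk(m)}`, such that
each side has at least two elements, `m⁺ ∈ plus`, `m⁻ ∈ minus`, and any two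
distinct vertices in the same connected component of the subgraph of `Γ`
induced on `V ∖ st(m)` have all four of their elements in the same side. -/
structure GWPartition [Fintype V] (Γ : SimpleGraph V) (m : V) where
  plus : Set (V × Bool)
  minus : Set (V × Bool)
  disjoint_sides : Disjoint plus minus
  union_sides : plus ∪ minus = {x : V × Bool | x.1 ∉ Γ.neighborSet m}
  thick_plus : 2 ≤ plus.ncard
  thick_minus : 2 ≤ minus.ncard
  base_plus : (m, true) ∈ plus
  base_minus : (m, false) ∈ minus
  component_const :
    ∀ a b : ({x : V | x ∉ gstar Γ m} : Set V), (a : V) ≠ (b : V) →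
      (Γ.induce {x : V | x ∉ gstar Γ m}).Reachable a b →
      (({((a : V), true), ((a : V), false), ((b : V), true), ((b : V), false)} :
          Set (V × Bool)) ⊆ plus ∨
        ({((a : V), true), ((a : V), false), ((b : V), true), ((b : V), false)} :
          Set (V × Bool)) ⊆ minus)

variable [Fintype V] {Γ : SimpleGraph V} {m : V}

/-- `P` splits the vertex `v` if `v⁺` and `v⁻` lie in different sides of `P`. -/
def GWPartition.Splits (P : GWPartition Γ m) (v : V) : Prop :=
  ((v, true) ∈ P.plus ∧ (v, false) ∈ P.minus) ∨
    ((v, true) ∈ P.minus ∧ (v, false) ∈ P.plus)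

/-- The set `Sing(P)` of vertices split by `P`. -/
def GWPartition.sing (P : GWPartition Γ m) : Set V := {v | P.Splits v}

/-- `max(P)`: the set of vertices split by `P` that are maximal in `Sing(P)`
with respect to the relation `v ≤ u ↔ lk(v) ⊆ st(u)`. -/
def GWPartition.maxSet (P : GWPartition Γ m) : Set V :=
  {v | P.Splits v ∧ ∀ u, P.Splits u →
    Γ.neighborSet v ⊆ gstar Γ u → Γ.neighborSet u ⊆ gstar Γ v}

/-- A vertex split by a Γ-Whitehead partition based at `m` is not adjacent to `m`. -/
theorem GWPartition.Splits.notMem_neighborSet {P : GWPartition Γ m} {v : V}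
    (hv : P.Splits v) : v ∉ Γ.neighborSet m := by
  have h : (v, true) ∈ P.plus ∪ P.minus := hv.imp And.left And.left
  rwa [P.union_sides] at h

/-- If a Γ-Whitehead partition based at `m` splits the vertex `v`, then
`lk(v) ⊆ lk(m)` (i.e. `v ≤_f m`). -/
theorem stmt_4 (P : GWPartition Γ m) (v : V) (hv : P.Splits v) :
    Γ.neighborSet v ⊆ Γ.neighborSet m := by
  intro w hvw
  by_contra hw
  have hvm : v ∉ Γ.neighborSet m := hv.notMem_neighborSet
  have hne : v ≠ m := fun h => hw (h ▸ hvw)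
  have hwne : w ≠ m := fun h => hvm (h ▸ Γ.adj_symm hvw)
  have hv' : v ∉ gstar Γ m := fun h => h.elim hne hvm
  have hw' : w ∉ gstar Γ m := fun h => h.elim hwne hw
  have hadj : (Γ.induce {x : V | x ∉ gstar Γ m}).Adj ⟨v, hv'⟩ ⟨w, hw'⟩ := hvw
  have hside := P.component_const ⟨v, hv'⟩ ⟨w, hw'⟩ (Γ.ne_of_adj hvw) hadj.reachable
  simp only [Set.insert_subset_iff] at hside
  have hdisj : ∀ ⦃x⦄, x ∈ P.plus → x ∉ P.minus := Set.disjoint_left.mp P.disjoint_sides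
  rcases hside with ⟨ht, hf, -⟩ | ⟨ht, hf, -⟩ <;> rcases hv with ⟨h₁, h₂⟩ | ⟨h₁, h₂⟩
  · exact hdisj hf h₂
  · exact hdisj ht h₁
  · exact hdisj h₁ ht
  · exact hdisj h₂ hf
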